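/- arXiv:1502.06799 — 2 statements merged into one kernel-verified Lean document; each statement's English description precedes it below -/
import Mathlib

section
/- For every integer T≥2, every a ∈ ℝ and every b ≥ 0: P[max_{k=1,...,T} Z_k ≤ a] ≥ Φ(a−b) · P[max_{k=1,...,T−1} Z_k ≤ b], where Φ denotes the standard normal cumulative distribution function. -/
open MeasureTheory Filter ProbabilityTheory

/-- A linear form on `ι → ℝ` is determined by its values on the standard basis. -/
lemma StrongDual.pi_apply_eq_sum {ι : Type*} [Fintype ι] [DecidableEq ι]
    (L : StrongDual ℝ (ι → ℝ)) (x : ι → ℝ) : L x = ∑ i, L (Pi.single i 1) * x i := by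
  conv_lhs => rw [pi_eq_sum_univ' x, map_sum]
  simp [mul_comm]

/-- A finite family of real random variables all of whose linear combinations are Gaussian is
jointly Gaussian. -/
lemma hasGaussianLaw_pi_of_forall_linearCombination {Ω ι : Type*} [MeasurableSpace Ω] [Fintype ι]
    {P : Measure Ω} {Y : ι → Ω → ℝ} (hY : ∀ i, Measurable (Y i))
    (h : ∀ c : ι → ℝ, ∃ (m : ℝ) (v : NNReal),
      P.map (fun ω => ∑ i, c i * Y i ω) = gaussianReal m v) :
    HasGaussianLaw (fun ω i => Y i ω) P := by
  classical
  refine ⟨isGaussian_of_map_eq_gaussianReal fun L => ?_⟩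
  obtain ⟨m, v, hv⟩ := h fun i => L (Pi.single i 1)
  refine ⟨m, v, ?_⟩
  rw [Measure.map_map (by fun_prop) (by fun_prop), ← hv]
  congr 1
  ext ω
  exact StrongDual.pi_apply_eq_sum L _

/-- Two finite Gaussian families with the same means and covariances have the same law. -/
lemma HasGaussianLaw.map_eq_of_covariance_eq {Ω ι : Type*} [MeasurableSpace Ω] [Fintype ι]
    {P : Measure Ω} {Y Y' : ι → Ω → ℝ}
    (hY : HasGaussianLaw (fun ω i => Y i ω) P) (hY' : HasGaussianLaw (fun ω i => Y' i ω) P)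
    (hmean : ∀ i, ∫ ω, Y i ω ∂P = ∫ ω, Y' i ω ∂P)
    (hcov : ∀ i j, cov[Y i, Y j; P] = cov[Y' i, Y' j; P]) :
    P.map (fun ω i => Y i ω) = P.map (fun ω i => Y' i ω) := by
  classical
  have := hY.isProbabilityMeasure
  have := hY.isGaussian_map
  have := hY'.isGaussian_map
  have key : ∀ W : ι → Ω → ℝ, HasGaussianLaw (fun ω i => W i ω) P →
      ∀ L : StrongDual ℝ (ι → ℝ),
        (∫ ω, L (fun i => W i ω) ∂P = ∑ i, L (Pi.single i 1) * ∫ ω, W i ω ∂P) ∧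
        Var[fun ω => L (fun i => W i ω); P] =
          ∑ i, ∑ j, L (Pi.single i 1) * (L (Pi.single j 1) * cov[W i, W j; P]) := by
    intro W hW L
    have hL : (fun ω => L (fun i => W i ω)) = fun ω => ∑ i, L (Pi.single i 1) * W i ω :=
      funext fun ω => StrongDual.pi_apply_eq_sum L _
    have hmem : ∀ i, MemLp (W i) 2 P := fun i => (hW.eval i).memLp_two
    have hmeas : ∀ i, AEMeasurable (W i) P := fun i => (hW.eval i).aemeasurable
    rw [hL]
    constructor
    · rw [integral_finsetSum _ fun i _ => ((hW.eval i).integrable.const_mul _)]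
      simp_rw [integral_const_mul]
    · rw [← covariance_self (by fun_prop), covariance_fun_sum_fun_sum
        (fun i => (hmem i).const_mul _) (fun i => (hmem i).const_mul _)]
      simp_rw [covariance_const_mul_left, covariance_const_mul_right]
  apply Measure.ext_of_charFunDual
  ext L
  rw [hY.charFunDual_map_eq_fun, hY'.charFunDual_map_eq_fun, (key Y hY L).1, (key Y hY L).2,
    (key Y' hY' L).1, (key Y' hY' L).2]
  simp_rw [hmean, hcov]

/-- Two lower sets of a linear order are positively correlated under any probability measure. -/
lemma IsLowerSet.measure_mul_le_measure_inter {α : Type*} [LinearOrder α] [MeasurableSpace α]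
    {μ : Measure α} [IsProbabilityMeasure μ] {s t : Set α} (hs : IsLowerSet s)
    (ht : IsLowerSet t) : μ s * μ t ≤ μ (s ∩ t) := by
  rcases hs.total ht with h | h
  · rw [Set.inter_eq_left.2 h]
    exact mul_le_of_le_one_right' prob_le_one
  · rw [Set.inter_eq_right.2 h]
    exact mul_le_of_le_one_left' prob_le_one

/-- If `U` is jointly Gaussian and nonnegatively correlated with all `V i`, then the events
`U ≤ c` and `∀ i, V i ≤ b i` are positively correlated. -/
lemma HasGaussianLaw.measure_le_mul_measure_forall_le {Ω ι : Type*} [MeasurableSpace Ω]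
    [Fintype ι] {P : Measure Ω} {U : Ω → ℝ} {V : ι → Ω → ℝ}
    (hU : Measurable U) (hV : ∀ i, Measurable (V i))
    (hUV : HasGaussianLaw (fun ω => (U ω, fun i => V i ω)) P)
    (hvar : Var[U; P] ≠ 0) (hcov : ∀ i, 0 ≤ cov[U, V i; P]) (c : ℝ) (b : ι → ℝ) :
    P {ω | U ω ≤ c} * P {ω | ∀ i, V i ω ≤ b i} ≤ P {ω | U ω ≤ c ∧ ∀ i, V i ω ≤ b i} := by
  have := hUV.isProbabilityMeasure
  set α : ι → ℝ := fun i => cov[U, V i; P] / Var[U; P] with hα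
  have hα0 : ∀ i, 0 ≤ α i := fun i => div_nonneg (hcov i) (variance_nonneg _ _)
  set W : ι → Ω → ℝ := fun i ω => V i ω - α i * U ω with hW
  have hWm : Measurable fun ω i => W i ω := by fun_prop
  have hU2 : MemLp U 2 P := hUV.fst.memLp_two
  have hV2 : ∀ i, MemLp (V i) 2 P := fun i => (hUV.snd.eval i).memLp_two
  have hind : IndepFun U (fun ω i => W i ω) P := by
    let K : ℝ × (ι → ℝ) →L[ℝ] (Unit → ℝ) × (ι → ℝ) :=
      (ContinuousLinearMap.pi fun _ => ContinuousLinearMap.fst ℝ ℝ (ι → ℝ)).prod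
        (ContinuousLinearMap.pi fun i =>
          (ContinuousLinearMap.proj i).comp (ContinuousLinearMap.snd ℝ ℝ (ι → ℝ)) -
            α i • ContinuousLinearMap.fst ℝ ℝ (ι → ℝ))
    have hK : HasGaussianLaw (fun ω => (fun _ : Unit => U ω, fun i => W i ω)) P :=
      hUV.map_fun K
    have := hK.indepFun_of_covariance_eval (X := fun _ => U) fun _ i => by
      rw [hW, covariance_fun_sub_right hU2 (hV2 i) (hU2.const_mul _),
        covariance_const_mul_right, covariance_self hU.aemeasurable, hα]
      field_simp
      simp
    exact this.comp (measurable_pi_apply ()) measurable_id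
  have hlaw := (indepFun_iff_map_prod_eq_prod_map_map hU.aemeasurable hWm.aemeasurable).1 hind
  have := Measure.isProbabilityMeasure_map (μ := P) hU.aemeasurable
  have := Measure.isProbabilityMeasure_map (μ := P) hWm.aemeasurable
  set μ := P.map U
  set ν := P.map fun ω i => W i ω
  set D : Set (ℝ × (ι → ℝ)) := {p | ∀ i, p.2 i + α i * p.1 ≤ b i} with hD
  have hDm : MeasurableSet D := by
    rw [hD, Set.ofPred_forall]
    exact MeasurableSet.iInter fun i => measurableSet_le (by fun_prop) (by fun_prop)
  have hCm : MeasurableSet {p : ℝ × (ι → ℝ) | p.1 ≤ c} :=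
    measurableSet_le (by fun_prop) (by fun_prop)
  have hpair : Measurable fun ω => (U ω, fun i => W i ω) := hU.prodMk hWm
  have e1 : P {ω | U ω ≤ c} = μ (Set.Iic c) := (Measure.map_apply hU measurableSet_Iic).symm
  have e2 : P {ω | ∀ i, V i ω ≤ b i} = μ.prod ν D := by
    rw [← hlaw, Measure.map_apply hpair hDm]
    simp [hD, hW]
  have e3 : P {ω | U ω ≤ c ∧ ∀ i, V i ω ≤ b i} = μ.prod ν ({p | p.1 ≤ c} ∩ D) := by
    rw [← hlaw, Measure.map_apply hpair (hCm.inter hDm)]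
    simp [hD, hW, Set.ofPred_and]
  rw [e1, e2, e3, Measure.prod_apply_symm hDm, Measure.prod_apply_symm (hCm.inter hDm),
    ← lintegral_const_mul _ (measurable_measure_prodMk_right hDm)]
  refine lintegral_mono fun w => ?_
  refine IsLowerSet.measure_mul_le_measure_inter (isLowerSet_Iic c) ?_
  intro x y hyx hx i
  exact (add_le_add_right (mul_le_mul_of_nonneg_left hyx (hα0 i)) _).trans (hx i)

/-- Summing over an initial segment of `Fin n` is summing over an initial segment of `ℕ`. -/
lemma Fin.sum_Iic_val {M : Type*} [AddCommMonoid M] {n : ℕ} (k : Fin n) (f : ℕ → M) :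
    ∑ j ∈ Finset.Iic k, f j = ∑ j ∈ Finset.range (k + 1), f j := by
  rw [Nat.range_succ_eq_Iic, ← Fin.map_valEmbedding_Iic, Finset.sum_map]
  rfl

/-- Let `(X_i)_{i ≥ 1}` be a stationary centered Gaussian sequence with `E[X_i²] = 1` and
nonnegative correlations `r j = E[X_k X_{k+j}]` independent of `k`, and let
`Z_n = ∑_{i=1}^n X_i`.  Then for every integer `T ≥ 2`, every `a ∈ ℝ` and every `b ≥ 0`,
`P[max_{k=1,…,T} Z_k ≤ a] ≥ Φ(a - b) · P[max_{k=1,…,T-1} Z_k ≤ b]`, where `Φ` is the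
standard normal cumulative distribution function. -/
theorem stmt11
    {Ω : Type*} [MeasurableSpace Ω] (P : Measure Ω) [IsProbabilityMeasure P]
    (X : ℕ → Ω → ℝ) (hXmeas : ∀ i, Measurable (X i))
    (hgauss : ∀ s : Finset ℕ, (∀ i ∈ s, 1 ≤ i) → ∀ c : ℕ → ℝ,
      ∃ v : NNReal,
        Measure.map (fun ω => ∑ i ∈ s, c i * X i ω) P = gaussianReal 0 v)
    (r : ℕ → ℝ) (hrnonneg : ∀ j, 0 ≤ r j) (hr0 : r 0 = 1)
    (hrcov : ∀ k, 1 ≤ k → ∀ j, ∫ ω, X k ω * X (k + j) ω ∂P = r j)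
    (Z : ℕ → Ω → ℝ) (hZ : ∀ n ω, Z n ω = ∑ i ∈ Finset.Icc 1 n, X i ω) :
    ∀ T : ℕ, 2 ≤ T → ∀ a : ℝ, ∀ b : ℝ, 0 ≤ b →
      (gaussianReal 0 1 (Set.Iic (a - b))).toReal *
          (P {ω | ∀ k ∈ Finset.Icc 1 (T - 1), Z k ω ≤ b}).toReal ≤
        (P {ω | ∀ k ∈ Finset.Icc 1 T, Z k ω ≤ a}).toReal := by
  intro T hT a b hb
  obtain ⟨m, rfl⟩ : ∃ m, T = m + 1 := ⟨T - 1, by omega⟩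
  rw [Nat.add_sub_cancel]
  have hsingle : ∀ i, ∃ v : NNReal, P.map (X (i + 1)) = gaussianReal 0 v := fun i => by
    simpa using hgauss {i + 1} (by simp) fun _ => 1
  have hmean : ∀ i, ∫ ω, X (i + 1) ω ∂P = 0 := fun i => by
    obtain ⟨v, hv⟩ := hsingle i
    have := integral_map (μ := P) (hXmeas (i + 1)).aemeasurable
      (f := fun x : ℝ => x) (by fun_prop)
    rw [← this, hv, integral_id_gaussianReal]
  have hY : HasGaussianLaw (fun ω (i : Fin (m + 1)) => X (i + 1) ω) P :=
    hasGaussianLaw_pi_of_forall_linearCombination (fun i => hXmeas _) fun c => by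
      have hinj : Function.Injective fun i : Fin (m + 1) => (i : ℕ) + 1 :=
        fun i j hij => Fin.ext (Nat.succ_injective hij)
      obtain ⟨v, hv⟩ := hgauss (Finset.univ.map ⟨_, hinj⟩) (by simp)
        (Function.extend (fun i : Fin (m + 1) => (i : ℕ) + 1) c 0)
      refine ⟨0, v, ?_⟩
      simpa [hinj.extend_apply c] using hv
  have hmem : ∀ i, MemLp (X (i + 1)) 2 P := fun i => by
    obtain ⟨v, hv⟩ := hsingle i
    have : HasGaussianLaw (X (i + 1)) P := ⟨by rw [hv]; infer_instance⟩
    exact this.memLp_two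
  have hcov : ∀ i j, cov[X (i + 1), X (i + j + 1); P] = r j := fun i j => by
    rw [covariance_eq_sub (hmem _) (hmem _), hmean, hmean, ← hrcov (i + 1) (by omega) j]
    simp [add_right_comm]
  -- the two shifted families have the same law
  have hYs : HasGaussianLaw (fun ω (i : Fin m) => X (i.succ + 1) ω) P :=
    hY.map_fun (ContinuousLinearMap.pi fun i : Fin m => ContinuousLinearMap.proj i.succ)
  have hYc : HasGaussianLaw (fun ω (i : Fin m) => X (i + 1) ω) P :=
    hY.map_fun (ContinuousLinearMap.pi fun i : Fin m => ContinuousLinearMap.proj i.castSucc)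
  have hlaw : P.map (fun ω (i : Fin m) => X (i.succ + 1) ω) =
      P.map (fun ω (i : Fin m) => X (i + 1) ω) := by
    refine HasGaussianLaw.map_eq_of_covariance_eq hYs hYc (fun i => by simp [hmean]) ?_
    intro i j
    wlog hij : i ≤ j generalizing i j
    · rw [covariance_comm, this j i (le_of_not_ge hij), covariance_comm]
    obtain ⟨d, hd⟩ := Nat.exists_eq_add_of_le (Fin.le_def.1 hij)
    rw [hd, hcov, Fin.val_succ, Fin.val_succ, hd, add_right_comm (i : ℕ) d 1, hcov]
  let A : Set (Fin m → ℝ) := {x | ∀ k, ∑ j ∈ Finset.Iic k, x j ≤ b}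
  have hA : MeasurableSet A := by
    rw [show A = _ from Set.ofPred_forall _]
    exact MeasurableSet.iInter fun k => measurableSet_le (by fun_prop) (by fun_prop)
  have hZr : ∀ n ω, Z n ω = ∑ i ∈ Finset.range n, X (i + 1) ω := fun n ω => by
    rw [hZ, Finset.range_eq_Ico, Finset.sum_Ico_add' (fun i => X i ω)]
    rfl
  let V : Fin m → Ω → ℝ := fun k ω => ∑ j ∈ Finset.Iic k, X (j.succ + 1) ω
  have hVb : P {ω | ∀ k, V k ω ≤ b} = P {ω | ∀ k ∈ Finset.Icc 1 m, Z k ω ≤ b} := by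
    have h1 : {ω | ∀ k, V k ω ≤ b} = (fun ω (i : Fin m) => X (i.succ + 1) ω) ⁻¹' A := rfl
    have h2 : {ω | ∀ k ∈ Finset.Icc 1 m, Z k ω ≤ b} =
        (fun ω (i : Fin m) => X (i + 1) ω) ⁻¹' A := by
      ext ω
      simp only [Set.mem_ofPred_eq, Set.mem_preimage, A, Finset.mem_Icc,
        Fin.sum_Iic_val _ fun j => X (j + 1) ω, ← hZr]
      constructor
      · exact fun h k => h _ ⟨by omega, k.2⟩
      · rintro h k ⟨hk1, hk2⟩
        obtain ⟨k, rfl⟩ := Nat.exists_eq_add_of_le' hk1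
        exact h ⟨k, hk2⟩
    rw [h1, h2, ← Measure.map_apply (by fun_prop) hA, hlaw, Measure.map_apply (by fun_prop) hA]
  have hVar : Var[X 1; P] = 1 := by
    rw [← covariance_self (hXmeas 1).aemeasurable, ← hr0]
    exact hcov 0 0
  have hVcov : ∀ k, 0 ≤ cov[X 1, V k; P] := fun k => by
    rw [covariance_fun_sum_right' (fun j _ => hmem _) (hmem 0)]
    refine Finset.sum_nonneg fun j _ => ?_
    have := hcov 0 j.succ
    simp only [zero_add] at this
    exact this ▸ hrnonneg _
  have hUV : HasGaussianLaw (fun ω => (X 1 ω, fun k => V k ω)) P := by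
    let K : (Fin (m + 1) → ℝ) →L[ℝ] ℝ × (Fin m → ℝ) :=
      (ContinuousLinearMap.proj 0).prod (ContinuousLinearMap.pi fun k =>
        ∑ j ∈ Finset.Iic k, ContinuousLinearMap.proj j.succ)
    have hK : ∀ ω, (X 1 ω, fun k => V k ω) = K fun i => X (i + 1) ω := fun ω => by
      ext <;> simp [K, V]
    simp_rw [hK]
    exact hY.map_fun K
  have hmain := HasGaussianLaw.measure_le_mul_measure_forall_le (hXmeas 1) (by fun_prop) hUV
    (by rw [hVar]; exact one_ne_zero) hVcov (a - b) fun _ => b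
  have hΦ : P {ω | X 1 ω ≤ a - b} = gaussianReal 0 1 (Set.Iic (a - b)) := by
    obtain ⟨v, hv⟩ := hsingle 0
    have : v = 1 := by
      have := variance_map (X := id) (μ := P) (Y := X 1) (by fun_prop) (hXmeas 1).aemeasurable
      simp only [zero_add] at hv
      rw [hv, variance_id_gaussianReal, Function.id_comp, hVar] at this
      exact_mod_cast this
    rw [← this, ← hv, Measure.map_apply (hXmeas _) measurableSet_Iic]
    rfl
  rw [hΦ, hVb] at hmain
  rw [← ENNReal.toReal_mul]
  refine ENNReal.toReal_mono (measure_ne_top _ _) (hmain.trans (measure_mono ?_))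
  rintro ω ⟨h1, h2⟩ k hk
  obtain ⟨hk1, hk2⟩ := Finset.mem_Icc.1 hk
  obtain ⟨k, rfl⟩ := Nat.exists_eq_add_of_le' hk1
  rw [hZr, Finset.sum_range_succ']
  rcases k with _ | k
  · simp only [Finset.range_zero, Finset.sum_empty, zero_add]
    linarith
  · have := h2 ⟨k, by omega⟩
    simp only [V, Fin.val_succ] at this
    rw [Fin.sum_Iic_val _ fun j => X (j + 1 + 1) ω] at this
    simp only [zero_add] at this ⊢
    linarith
end

section
/- For every β>0 there exist c>0 and T₀ such that for all integers T≥T₀: P[max_{k=1,...,T} Z_k ≤ β log T] ≤ c (log T)^2 · P[max_{k=1,...,T} Z_k ≤ 1]. -/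
open MeasureTheory Filter ProbabilityTheory
open scoped Topology

section Association

variable {E : Type*} [NormedAddCommGroup E] [NormedSpace ℝ E]

/-- A `[0, 1]`-valued Lipschitz function with a first order Taylor expansion at every point, whose
derivative lies in the cone `S` of continuous linear functionals; `K` bounds the Lipschitz constant,
the derivative and the quadratic remainder. -/
structure SmoothConeMonotone (S : PointedCone ℝ (StrongDual ℝ E)) (K : ℝ) (f : E → ℝ) : Prop where
  nonneg : ∀ x, 0 ≤ f x
  le_one : ∀ x, f x ≤ 1
  lip : ∀ x h, |f (x + h) - f x| ≤ K * ‖h‖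
  taylor : ∀ x, ∃ L ∈ S, (∀ h, |L h| ≤ K * ‖h‖) ∧ ∀ h, |f (x + h) - f x - L h| ≤ K * ‖h‖ ^ 2

namespace SmoothConeMonotone

variable {S : PointedCone ℝ (StrongDual ℝ E)} {K K' : ℝ} {f g : E → ℝ}

lemma const_one : SmoothConeMonotone S 0 (fun _ => 1) where
  nonneg _ := zero_le_one
  le_one _ := le_rfl
  lip _ _ := by simp
  taylor _ := ⟨0, S.zero_mem, by simp, by simp⟩

lemma abs_le_one (hf : SmoothConeMonotone S K f) (x : E) : |f x| ≤ 1 :=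
  abs_le.2 ⟨by linarith [hf.nonneg x], hf.le_one x⟩

lemma continuous (hf : SmoothConeMonotone S K f) : Continuous f := by
  have : LipschitzWith K.toNNReal f := by
    refine LipschitzWith.of_dist_le_mul fun x y => ?_
    have h := hf.lip y (x - y)
    rw [add_sub_cancel] at h
    rw [Real.dist_eq, dist_eq_norm]
    exact h.trans (mul_le_mul_of_nonneg_right (Real.le_coe_toNNReal K) (norm_nonneg _))
  exact this.continuous

lemma mul (hf : SmoothConeMonotone S K f) (hg : SmoothConeMonotone S K' g) (hK : 0 ≤ K)
    (hK' : 0 ≤ K') : SmoothConeMonotone S (K + K' + K * K') (fun x => f x * g x) where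
  nonneg x := mul_nonneg (hf.nonneg x) (hg.nonneg x)
  le_one x := mul_le_one₀ (hf.le_one x) (hg.nonneg x) (hg.le_one x)
  lip x h := by
    have e : f (x + h) * g (x + h) - f x * g x =
      f (x + h) * (g (x + h) - g x) + g x * (f (x + h) - f x) := by ring
    rw [e]
    have h1 : |f (x + h) * (g (x + h) - g x)| ≤ 1 * (K' * ‖h‖) := by
      rw [abs_mul]
      exact mul_le_mul (hf.abs_le_one _) (hg.lip x h) (abs_nonneg _) zero_le_one
    have h2 : |g x * (f (x + h) - f x)| ≤ 1 * (K * ‖h‖) := by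
      rw [abs_mul]
      exact mul_le_mul (hg.abs_le_one _) (hf.lip x h) (abs_nonneg _) zero_le_one
    have := abs_add_le (f (x + h) * (g (x + h) - g x)) (g x * (f (x + h) - f x))
    have : 0 ≤ K * K' * ‖h‖ := by positivity
    linarith
  taylor x := by
    obtain ⟨L, hL, hLb, hLt⟩ := hf.taylor x
    obtain ⟨M, hM, hMb, hMt⟩ := hg.taylor x
    refine ⟨f x • M + g x • L, S.add_mem (S.smul_mem (hf.nonneg x) hM)
      (S.smul_mem (hg.nonneg x) hL), fun h => ?_, fun h => ?_⟩
    · have h1 : |f x * M h| ≤ 1 * (K' * ‖h‖) := by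
        rw [abs_mul]
        exact mul_le_mul (hf.abs_le_one _) (hMb h) (abs_nonneg _) zero_le_one
      have h2 : |g x * L h| ≤ 1 * (K * ‖h‖) := by
        rw [abs_mul]
        exact mul_le_mul (hg.abs_le_one _) (hLb h) (abs_nonneg _) zero_le_one
      have := abs_add_le (f x * M h) (g x * L h)
      have : 0 ≤ K * K' * ‖h‖ := by positivity
      simp only [add_apply, smul_apply, smul_eq_mul]
      linarith
    · have h1 : |f x * (g (x + h) - g x - M h)| ≤ 1 * (K' * ‖h‖ ^ 2) := by
        rw [abs_mul]
        exact mul_le_mul (hf.abs_le_one _) (hMt h) (abs_nonneg _) zero_le_one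
      have h2 : |g x * (f (x + h) - f x - L h)| ≤ 1 * (K * ‖h‖ ^ 2) := by
        rw [abs_mul]
        exact mul_le_mul (hg.abs_le_one _) (hLt h) (abs_nonneg _) zero_le_one
      have h3 : |(f (x + h) - f x) * (g (x + h) - g x)| ≤ (K * ‖h‖) * (K' * ‖h‖) := by
        rw [abs_mul]
        exact mul_le_mul (hf.lip x h) (hg.lip x h) (abs_nonneg _) (by positivity)
      have e : f (x + h) * g (x + h) - f x * g x - (f x • M + g x • L) h =
          f x * (g (x + h) - g x - M h) + g x * (f (x + h) - f x - L h)
          + (f (x + h) - f x) * (g (x + h) - g x) := by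
        simp only [add_apply, smul_apply, smul_eq_mul]
        ring
      rw [e]
      refine (abs_add_three _ _ _).trans ?_
      linarith

lemma comp_affine (hf : SmoothConeMonotone S K f) (hK : 0 ≤ K) {s : ℝ} (hs : 0 ≤ s) (hs1 : s ≤ 1)
    (b : E) : SmoothConeMonotone S K (fun x => f (s • x + b)) where
  nonneg _ := hf.nonneg _
  le_one _ := hf.le_one _
  lip x h := by
    have := hf.lip (s • x + b) (s • h)
    rw [norm_smul, Real.norm_of_nonneg hs] at this
    rw [show s • (x + h) + b = s • x + b + s • h by rw [smul_add]; abel]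
    exact this.trans (mul_le_mul_of_nonneg_left
      (mul_le_of_le_one_left (norm_nonneg h) hs1) hK)
  taylor x := by
    obtain ⟨L, hL, hLb, hLt⟩ := hf.taylor (s • x + b)
    refine ⟨s • L, S.smul_mem hs hL, fun h => ?_, fun h => ?_⟩
    · rw [smul_apply, smul_eq_mul, abs_mul, abs_of_nonneg hs]
      exact (mul_le_of_le_one_left (abs_nonneg _) hs1).trans (hLb h)
    · have := hLt (s • h)
      rw [norm_smul, Real.norm_of_nonneg hs, map_smul] at this
      rw [show s • (x + h) + b = s • x + b + s • h by rw [smul_add]; abel]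
      exact this.trans (mul_le_mul_of_nonneg_left
        (pow_le_pow_left₀ (by positivity) (mul_le_of_le_one_left (norm_nonneg h) hs1) 2) hK)

end SmoothConeMonotone

lemma abs_sigmoid_sub_le (x h : ℝ) : |Real.sigmoid (x + h) - Real.sigmoid x| ≤ |h| := by
  have := Convex.norm_image_sub_le_of_norm_hasDerivWithin_le (f := Real.sigmoid)
    (f' := fun x => Real.sigmoid x * (1 - Real.sigmoid x)) (C := 1) (s := Set.univ)
    (fun x _ => (Real.hasDerivAt_sigmoid x).hasDerivWithinAt) (fun x _ => by
      rw [Real.norm_eq_abs, abs_le]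
      constructor <;> nlinarith [Real.sigmoid_nonneg x, Real.sigmoid_le_one x])
    convex_univ (Set.mem_univ x) (Set.mem_univ (x + h))
  simpa using this

lemma abs_sigmoid_taylor_le (x h : ℝ) :
    |Real.sigmoid (x + h) - Real.sigmoid x - Real.sigmoid x * (1 - Real.sigmoid x) * h|
      ≤ h ^ 2 := by
  set d : ℝ → ℝ := fun x => Real.sigmoid x * (1 - Real.sigmoid x) with hd
  have hlip : ∀ y k, |d (y + k) - d y| ≤ |k| := by
    intro y k
    have e : d (y + k) - d y = (Real.sigmoid (y + k) - Real.sigmoid y) *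
      (1 - Real.sigmoid (y + k) - Real.sigmoid y) := by simp only [hd]; ring
    rw [e, abs_mul]
    have h1 : |1 - Real.sigmoid (y + k) - Real.sigmoid y| ≤ 1 := by
      rw [abs_le]
      constructor <;> linarith [Real.sigmoid_nonneg y, Real.sigmoid_le_one y,
        Real.sigmoid_nonneg (y + k), Real.sigmoid_le_one (y + k)]
    exact (mul_le_of_le_one_right (abs_nonneg _) h1).trans (abs_sigmoid_sub_le y k)
  have := Convex.norm_image_sub_le_of_norm_hasDerivWithin_le
    (f := fun y => Real.sigmoid y - d x * y)
    (f' := fun y => d y - d x) (C := |h|) (s := Set.uIcc x (x + h)) (x := x) (y := x + h)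
    (fun y _ => ((Real.hasDerivAt_sigmoid y).sub
      (by simpa using (hasDerivAt_id y).const_mul (d x))).hasDerivWithinAt)
    (fun y hy => by
      have h1 := hlip x (y - x)
      rw [add_sub_cancel] at h1
      have h2 := Set.abs_sub_left_of_mem_uIcc hy
      rw [add_sub_cancel_left] at h2
      exact h1.trans h2)
    (convex_uIcc x (x + h)) Set.left_mem_uIcc Set.right_mem_uIcc
  have e : Real.sigmoid (x + h) - Real.sigmoid x - d x * h =
    Real.sigmoid (x + h) - d x * (x + h) - (Real.sigmoid x - d x * x) := by ring
  change |Real.sigmoid (x + h) - Real.sigmoid x - d x * h| ≤ _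
  rw [e]
  simpa [← sq] using this

lemma SmoothConeMonotone.sigmoid {S : PointedCone ℝ (StrongDual ℝ E)} {L : StrongDual ℝ E}
    (hL : L ∈ S) (c : ℝ) :
    SmoothConeMonotone S (‖L‖ + ‖L‖ ^ 2) (fun x => Real.sigmoid (L x + c)) where
  nonneg _ := Real.sigmoid_nonneg _
  le_one _ := Real.sigmoid_le_one _
  lip x h := by
    have := abs_sigmoid_sub_le (L x + c) (L h)
    rw [map_add, add_right_comm]
    have h2 : |L h| ≤ ‖L‖ * ‖h‖ := L.le_opNorm h
    have : 0 ≤ ‖L‖ ^ 2 * ‖h‖ := by positivity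
    linarith
  taylor x := by
    have h0 := Real.sigmoid_nonneg (L x + c)
    have h1 := Real.sigmoid_le_one (L x + c)
    have hL' : ∀ h, |L h| ≤ ‖L‖ * ‖h‖ := L.le_opNorm
    refine ⟨(Real.sigmoid (L x + c) * (1 - Real.sigmoid (L x + c))) • L,
      S.smul_mem (mul_nonneg h0 (by linarith)) hL, fun h => ?_, fun h => ?_⟩
    · rw [smul_apply, smul_eq_mul, abs_mul,
        abs_of_nonneg (mul_nonneg h0 (by linarith))]
      refine (mul_le_of_le_one_left (abs_nonneg _) (by nlinarith)).trans ((hL' h).trans ?_)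
      have : 0 ≤ ‖L‖ ^ 2 * ‖h‖ := by positivity
      linarith
    · have := abs_sigmoid_taylor_le (L x + c) (L h)
      rw [map_add, add_right_comm, smul_apply, smul_eq_mul]
      have h3 : L h ^ 2 ≤ (‖L‖ * ‖h‖) ^ 2 := by
        rw [← sq_abs]
        exact pow_le_pow_left₀ (abs_nonneg _) (hL' h) 2
      have : 0 ≤ ‖L‖ * ‖h‖ ^ 2 := by positivity
      nlinarith


section Measure

variable [MeasurableSpace E] [BorelSpace E] [SecondCountableTopology E] {μ : Measure E}
  [IsProbabilityMeasure μ] {S : PointedCone ℝ (StrongDual ℝ E)} {K K' : ℝ} {f g : E → ℝ}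

lemma integrable_of_continuous_of_abs_le_one {F : Type*} [TopologicalSpace F] [MeasurableSpace F]
    [OpensMeasurableSpace F] {ν : Measure F} [IsFiniteMeasure ν]
    {φ : F → ℝ} (hφ : Continuous φ) (hb : ∀ x, |φ x| ≤ 1) : Integrable φ ν :=
  .of_bound hφ.measurable.aestronglyMeasurable 1 (ae_of_all _ hb)

lemma integral_rotation
    (hrot : ∀ θ, (μ.prod μ).map (ContinuousLinearMap.rotation θ) = μ.prod μ)
    (θ : ℝ) {F : E × E → ℝ} (hF : Continuous F) :
    ∫ p, F (Real.cos θ • p.1 + Real.sin θ • p.2, -Real.sin θ • p.1 + Real.cos θ • p.2) ∂(μ.prod μ)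
      = ∫ p, F p ∂(μ.prod μ) := by
  conv_rhs => rw [← hrot θ]
  rw [integral_map (by fun_prop) hF.measurable.aestronglyMeasurable]
  rfl

lemma integral_prod_fst (φ : E → ℝ) : ∫ p, φ p.1 ∂(μ.prod μ) = ∫ x, φ x ∂μ := by
  simp [integral_fun_fst]

lemma measurePreserving_neg_of_rotation
    (hrot : ∀ θ, (μ.prod μ).map (ContinuousLinearMap.rotation θ) = μ.prod μ) :
    MeasurePreserving (fun x : E => -x) μ μ := by
  refine ⟨by fun_prop, ?_⟩
  have h1 : (μ.prod μ).map Prod.fst = μ := by simp [Measure.map_fst_prod]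
  have h2 := congrArg (Measure.map Prod.fst) (hrot Real.pi)
  rw [Measure.map_map (by fun_prop) (by fun_prop), h1] at h2
  conv_lhs => rw [← h1]
  rw [Measure.map_map (by fun_prop) (by fun_prop)]
  refine Eq.trans ?_ h2
  congr 1
  ext p
  simp [ContinuousLinearMap.rotation_apply]

lemma integral_add_smul
    (hrot : ∀ θ, (μ.prod μ).map (ContinuousLinearMap.rotation θ) = μ.prod μ)
    {h : E → ℝ} (hc : Continuous h) (a b : ℝ) :
    ∫ p, h (a • p.1 + b • p.2) ∂(μ.prod μ) = ∫ x, h (√(a ^ 2 + b ^ 2) • x) ∂μ := by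
  set z : ℂ := ⟨a, b⟩
  have hz : ‖z‖ = √(a ^ 2 + b ^ 2) := by
    rw [Complex.norm_def, Complex.normSq_apply]; simp [z, sq]
  have ha : √(a ^ 2 + b ^ 2) * Real.cos z.arg = a := by rw [← hz, Complex.norm_mul_cos_arg]
  have hb : √(a ^ 2 + b ^ 2) * Real.sin z.arg = b := by rw [← hz, Complex.norm_mul_sin_arg]
  rw [← integral_prod_fst fun x => h (√(a ^ 2 + b ^ 2) • x), ← integral_rotation hrot z.arg
    (F := fun p => h (√(a ^ 2 + b ^ 2) • p.1)) (by fun_prop)]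
  refine integral_congr_ae (ae_of_all _ fun p => ?_)
  simp only [smul_add, smul_smul, ha, hb]

/-- Lower bound for the Dirichlet form of two monotone functions. -/
lemma le_integral_symm_diff_mul (hf : SmoothConeMonotone S K f) (hg : SmoothConeMonotone S K' g)
    (hK : 0 ≤ K)
    (hS : ∀ L ∈ S, ∀ M ∈ S, 0 ≤ ∫ x, L x * M x ∂μ)
    (hcube : Integrable (fun x => ‖x‖ ^ 3) μ) (hsq : ∀ L M : StrongDual ℝ E,
      Integrable (fun x => L x * M x) μ) (α : ℝ) {β : ℝ} (hβ : 0 ≤ β) :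
    -(8 * K * K' * β ^ 3 * ∫ x, ‖x‖ ^ 3 ∂μ) ≤
      ∫ p, (f (α • p.1 + β • p.2) - f (α • p.1 - β • p.2)) *
        (g (α • p.1 + β • p.2) - g (α • p.1 - β • p.2)) ∂(μ.prod μ) := by
  have hfc := hf.continuous
  have hgc := hg.continuous
  have hab : ∀ x y, |(f x - f y) * (g x - g y)| ≤ 1 := by
    intro x y
    rw [abs_mul]
    refine mul_le_one₀ ?_ (abs_nonneg _) ?_ <;> rw [abs_le] <;> constructor <;>
      linarith [hf.nonneg x, hf.nonneg y, hf.le_one x, hf.le_one y,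
        hg.nonneg x, hg.nonneg y, hg.le_one x, hg.le_one y]
  have hi : Integrable (fun p : E × E => (f (α • p.1 + β • p.2) - f (α • p.1 - β • p.2)) *
        (g (α • p.1 + β • p.2) - g (α • p.1 - β • p.2))) (μ.prod μ) :=
    integrable_of_continuous_of_abs_le_one (by fun_prop) fun _ => hab _ _
  rw [integral_prod _ hi]
  have hconst : -(8 * K * K' * β ^ 3 * ∫ x, ‖x‖ ^ 3 ∂μ) =
    ∫ _, -(8 * K * K' * β ^ 3 * ∫ x, ‖x‖ ^ 3 ∂μ) ∂μ := by simp
  rw [hconst]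
  refine integral_mono (integrable_const _) hi.integral_prod_left fun m => ?_
  obtain ⟨L, hL, hLb, hLt⟩ := hf.taylor (α • m)
  obtain ⟨M, hM, hMb, hMt⟩ := hg.taylor (α • m)
  have hlow : ∫ z, (4 * β ^ 2 * (L z * M z) - 8 * K * K' * β ^ 3 * ‖z‖ ^ 3) ∂μ =
      4 * β ^ 2 * ∫ z, L z * M z ∂μ - 8 * K * K' * β ^ 3 * ∫ z, ‖z‖ ^ 3 ∂μ := by
    rw [integral_sub ((hsq L M).const_mul _) (hcube.const_mul _), integral_const_mul,
      integral_const_mul]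
  have hpos := mul_nonneg (show 0 ≤ 4 * β ^ 2 by positivity) (hS L hL M hM)
  refine (show _ ≤ ∫ z, (4 * β ^ 2 * (L z * M z) - 8 * K * K' * β ^ 3 * ‖z‖ ^ 3) ∂μ by
    rw [hlow]; linarith).trans ?_
  refine integral_mono (((hsq L M).const_mul _).sub (hcube.const_mul _))
    (integrable_of_continuous_of_abs_le_one (by fun_prop) fun _ => hab _ _) fun z => ?_
  have hn : ‖β • z‖ = β * ‖z‖ := by rw [norm_smul, Real.norm_of_nonneg hβ]
  have expand : ∀ (q : E → ℝ) (D : StrongDual ℝ E) (κ : ℝ),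
      (∀ h, |q (α • m + h) - q (α • m) - D h| ≤ κ * ‖h‖ ^ 2) →
      |q (α • m + β • z) - q (α • m - β • z) - 2 * β * D z| ≤ 2 * κ * β ^ 2 * ‖z‖ ^ 2 := by
    intro q D κ hq
    have h1 := hq (β • z)
    have h2 := hq (-(β • z))
    rw [norm_neg, hn, map_neg, map_smul, smul_eq_mul, ← sub_eq_add_neg] at h2
    rw [hn, map_smul, smul_eq_mul] at h1
    rw [abs_le] at *
    constructor <;> nlinarith
  have hF := expand f L K hLt
  have hG := expand g M K' hMt
  have hGlip : |g (α • m + β • z) - g (α • m - β • z)| ≤ 2 * K' * β * ‖z‖ := by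
    have := hg.lip (α • m - β • z) ((2 : ℝ) • (β • z))
    rw [show α • m - β • z + (2 : ℝ) • (β • z) = α • m + β • z by rw [two_smul]; abel, norm_smul,
      hn, Real.norm_two] at this
    linarith
  set Δf := f (α • m + β • z) - f (α • m - β • z)
  set Δg := g (α • m + β • z) - g (α • m - β • z)
  have hz := norm_nonneg z
  have e : Δf * Δg = 4 * β ^ 2 * (L z * M z) + 2 * β * (L z * (Δg - 2 * β * M z))
    + (Δf - 2 * β * L z) * Δg := by ring
  have b1 : |L z * (Δg - 2 * β * M z)| ≤ (K * ‖z‖) * (2 * K' * β ^ 2 * ‖z‖ ^ 2) := by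
    rw [abs_mul]
    exact mul_le_mul (hLb z) hG (abs_nonneg _) (by positivity)
  have b2 : |(Δf - 2 * β * L z) * Δg| ≤ (2 * K * β ^ 2 * ‖z‖ ^ 2) * (2 * K' * β * ‖z‖) := by
    rw [abs_mul]
    exact mul_le_mul hF hGlip (abs_nonneg _) (by positivity)
  have b1' := mul_le_mul_of_nonneg_left (neg_le_of_abs_le b1) (show 0 ≤ 2 * β by positivity)
  have b2' := neg_le_of_abs_le b2
  change _ ≤ Δf * Δg
  rw [e]
  linarith

lemma integral_mul_rotation_le (hf : SmoothConeMonotone S K f) (hg : SmoothConeMonotone S K' g)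
    (hK : 0 ≤ K)
    (hrot : ∀ θ, (μ.prod μ).map (ContinuousLinearMap.rotation θ) = μ.prod μ)
    (hS : ∀ L ∈ S, ∀ M ∈ S, 0 ≤ ∫ x, L x * M x ∂μ)
    (hcube : Integrable (fun x => ‖x‖ ^ 3) μ) (hsq : ∀ L M : StrongDual ℝ E,
      Integrable (fun x => L x * M x) μ) {θ : ℝ} (hθ : 0 ≤ Real.sin θ) :
    ∫ p, f p.1 * g (Real.cos (2 * θ) • p.1 + Real.sin (2 * θ) • p.2) ∂(μ.prod μ) ≤
      ∫ x, f x * g x ∂μ + 4 * K * K' * Real.sin θ ^ 3 * ∫ x, ‖x‖ ^ 3 ∂μ := by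
  have hfc := hf.continuous
  have hgc := hg.continuous
  have key := le_integral_symm_diff_mul hf hg hK hS hcube hsq (Real.cos θ) hθ
  set α := Real.cos θ with hα
  set β := Real.sin θ with hβ
  have hsq : β ^ 2 + α ^ 2 = 1 := Real.sin_sq_add_cos_sq θ
  have hI : ∀ u v : E × E → E, Continuous u → Continuous v →
      Integrable (fun p => f (u p) * g (v p)) (μ.prod μ) := fun u v hu hv =>
    integrable_of_continuous_of_abs_le_one (by fun_prop) fun p => by
      rw [abs_mul]
      exact mul_le_one₀ (hf.abs_le_one _) (abs_nonneg _) (hg.abs_le_one _)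
  have i1 := hI (fun p => α • p.1 + β • p.2) (fun p => α • p.1 + β • p.2) (by fun_prop)
    (by fun_prop)
  have i2 := hI (fun p => α • p.1 - β • p.2) (fun p => α • p.1 - β • p.2) (by fun_prop)
    (by fun_prop)
  have i3 := hI (fun p => α • p.1 + β • p.2) (fun p => α • p.1 - β • p.2) (by fun_prop)
    (by fun_prop)
  have i4 := hI (fun p => α • p.1 - β • p.2) (fun p => α • p.1 + β • p.2) (by fun_prop)
    (by fun_prop)
  have e1 : ∫ p, f (α • p.1 + β • p.2) * g (α • p.1 + β • p.2) ∂(μ.prod μ) =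
      ∫ x, f x * g x ∂μ := by
    rw [← integral_prod_fst fun x => f x * g x,
      ← integral_rotation hrot θ (F := fun p => f p.1 * g p.1)
      (by fun_prop)]
  have e2 : ∫ p, f (α • p.1 - β • p.2) * g (α • p.1 - β • p.2) ∂(μ.prod μ) =
      ∫ x, f x * g x ∂μ := by
    rw [← integral_prod_fst fun x => f x * g x,
      ← integral_rotation hrot (-θ) (F := fun p => f p.1 * g p.1)
      (by fun_prop)]
    simp [← sub_eq_add_neg, hα, hβ]
  have e4 : ∫ p, f (α • p.1 - β • p.2) * g (α • p.1 + β • p.2) ∂(μ.prod μ) =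
      ∫ p, f p.1 * g (Real.cos (2 * θ) • p.1 + Real.sin (2 * θ) • p.2) ∂(μ.prod μ) := by
    rw [← integral_rotation hrot (-θ)
      (F := fun p => f p.1 * g (Real.cos (2 * θ) • p.1 + Real.sin (2 * θ) • p.2))
      (by fun_prop)]
    refine integral_congr_ae (ae_of_all _ fun p => ?_)
    simp only [Real.cos_neg, Real.sin_neg, neg_smul, neg_neg, ← sub_eq_add_neg, ← hα, ← hβ,
      Real.cos_two_mul, Real.sin_two_mul]
    congr 2
    match_scalars
    · linear_combination (-2 * α) * hsq
    · ring
  have e3 : ∫ p, f (α • p.1 + β • p.2) * g (α • p.1 - β • p.2) ∂(μ.prod μ) =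
      ∫ p, f (α • p.1 - β • p.2) * g (α • p.1 + β • p.2) ∂(μ.prod μ) := by
    have hneg := (MeasurePreserving.id μ).prod (measurePreserving_neg_of_rotation hrot)
    conv_rhs => rw [← hneg.map_eq]
    rw [integral_map hneg.measurable.aemeasurable
      (Continuous.measurable (by fun_prop)).aestronglyMeasurable]
    simp [← sub_eq_add_neg]
  have expand : ∫ p, (f (α • p.1 + β • p.2) - f (α • p.1 - β • p.2)) *
        (g (α • p.1 + β • p.2) - g (α • p.1 - β • p.2)) ∂(μ.prod μ) =
      ∫ p, f (α • p.1 + β • p.2) * g (α • p.1 + β • p.2) ∂(μ.prod μ) +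
      ∫ p, f (α • p.1 - β • p.2) * g (α • p.1 - β • p.2) ∂(μ.prod μ) -
      ∫ p, f (α • p.1 + β • p.2) * g (α • p.1 - β • p.2) ∂(μ.prod μ) -
      ∫ p, f (α • p.1 - β • p.2) * g (α • p.1 + β • p.2) ∂(μ.prod μ) := by
    rw [← integral_add' i1 i2, ← integral_sub' (i1.add i2) i3,
      ← integral_sub' ((i1.add i2).sub i3) i4]
    refine integral_congr_ae (ae_of_all _ fun p => ?_)
    simp only [Pi.add_apply, Pi.sub_apply]
    ring
  rw [expand, e1, e2, e3, e4] at key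
  linarith

lemma integral_mul_correlated_le (hf : SmoothConeMonotone S K f) (hg : SmoothConeMonotone S K' g)
    (hK : 0 ≤ K) (hK' : 0 ≤ K')
    (hrot : ∀ θ, (μ.prod μ).map (ContinuousLinearMap.rotation θ) = μ.prod μ)
    (hS : ∀ L ∈ S, ∀ M ∈ S, 0 ≤ ∫ x, L x * M x ∂μ)
    (hcube : Integrable (fun x => ‖x‖ ^ 3) μ) (hsq : ∀ L M : StrongDual ℝ E,
      Integrable (fun x => L x * M x) μ) {θ : ℝ} (hθ : 0 ≤ Real.sin θ)
    {ρ : ℝ} (hρ : 0 ≤ ρ) (hρ1 : ρ ≤ 1) :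
    ∫ p, f p.1 * g ((ρ * Real.cos (2 * θ)) • p.1 + √(1 - (ρ * Real.cos (2 * θ)) ^ 2) • p.2)
        ∂(μ.prod μ) ≤
      ∫ p, f p.1 * g (ρ • p.1 + √(1 - ρ ^ 2) • p.2) ∂(μ.prod μ)
        + 4 * K * K' * Real.sin θ ^ 3 * ∫ x, ‖x‖ ^ 3 ∂μ := by
  have hfc := hf.continuous
  have hgc := hg.continuous
  have hb : ∀ x y, |f x * g y| ≤ 1 := fun x y => by
    rw [abs_mul]
    exact mul_le_one₀ (hf.abs_le_one _) (abs_nonneg _) (hg.abs_le_one _)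
  set t := Real.cos (2 * θ) with ht
  set γ := Real.sin (2 * θ) with hγ
  set σ := √(1 - ρ ^ 2) with hσ
  have hσ2 : σ ^ 2 = 1 - ρ ^ 2 := Real.sq_sqrt (by nlinarith)
  have htγ : γ ^ 2 + t ^ 2 = 1 := Real.sin_sq_add_cos_sq _
  have hi : Integrable (fun p : E × E => f p.1 * g (ρ • p.1 + σ • p.2)) (μ.prod μ) :=
    integrable_of_continuous_of_abs_le_one (by fun_prop) fun _ => hb _ _
  have hi3 : Integrable (fun q : E × (E × E) =>
      f q.2.1 * g (ρ • (t • q.2.1 + γ • q.2.2) + σ • q.1)) (μ.prod (μ.prod μ)) :=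
    integrable_of_continuous_of_abs_le_one (by fun_prop) fun _ => hb _ _
  have hi3' : Integrable (fun q : (E × E) × E =>
      f q.1.2 * g (ρ • (t • q.1.2 + γ • q.2) + σ • q.1.1)) ((μ.prod μ).prod μ) :=
    integrable_of_continuous_of_abs_le_one (by fun_prop) fun _ => hb _ _
  have hi4 : Integrable (fun p : E × E => f p.1 * g ((ρ * t) • p.1 + √(1 - (ρ * t) ^ 2) • p.2))
      (μ.prod μ) :=
    integrable_of_continuous_of_abs_le_one (by fun_prop) fun _ => hb _ _
  have hmono : ∫ y, ∫ p, f p.1 * g (ρ • (t • p.1 + γ • p.2) + σ • y) ∂(μ.prod μ) ∂μ ≤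
      ∫ y, (∫ x, f x * g (ρ • x + σ • y) ∂μ
        + 4 * K * K' * Real.sin θ ^ 3 * ∫ x, ‖x‖ ^ 3 ∂μ) ∂μ := by
    refine integral_mono hi3.integral_prod_left (hi.integral_prod_right.add (integrable_const _))
      fun y => ?_
    exact integral_mul_rotation_le hf (hg.comp_affine hK' hρ hρ1 (σ • y)) hK hrot hS hcube hsq hθ
  rw [integral_add hi.integral_prod_right (integrable_const _), integral_const, probReal_univ,
    one_smul] at hmono
  rw [integral_prod_symm _ hi]
  refine le_trans (le_of_eq ?_) hmono
  have hswap : ∫ y, ∫ p, f p.1 * g (ρ • (t • p.1 + γ • p.2) + σ • y) ∂(μ.prod μ) ∂μ =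
      ∫ x, ∫ y, ∫ z, f x * g (ρ • (t • x + γ • z) + σ • y) ∂μ ∂μ ∂μ := by
    rw [← integral_integral_swap (f := fun y x => ∫ z, f x * g (ρ • (t • x + γ • z) + σ • y) ∂μ)
      hi3'.integral_prod_left]
    refine integral_congr_ae (ae_of_all _ fun y => ?_)
    exact integral_prod _
      (integrable_of_continuous_of_abs_le_one (by fun_prop) fun _ => hb _ _)
  rw [hswap, integral_prod _ hi4]
  refine integral_congr_ae (ae_of_all _ fun x => ?_)
  have hadd := integral_add_smul hrot (h := fun w => f x * g ((ρ * t) • x + w)) (by fun_prop)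
    σ (ρ * γ)
  rw [integral_prod _
    (integrable_of_continuous_of_abs_le_one (by fun_prop) fun _ => hb _ _)] at hadd
  have hr : σ ^ 2 + (ρ * γ) ^ 2 = 1 - (ρ * t) ^ 2 := by
    linear_combination hσ2 + ρ ^ 2 * htγ
  rw [hr] at hadd
  change ∫ y, f x * g ((ρ * t) • x + √(1 - (ρ * t) ^ 2) • y) ∂μ = _
  rw [← hadd]
  refine integral_congr_ae (ae_of_all _ fun y => integral_congr_ae (ae_of_all _ fun z => ?_))
  dsimp only
  congr 2
  module

lemma integral_mul_correlated_pow_le (hf : SmoothConeMonotone S K f)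
    (hg : SmoothConeMonotone S K' g) (hK : 0 ≤ K) (hK' : 0 ≤ K')
    (hrot : ∀ θ, (μ.prod μ).map (ContinuousLinearMap.rotation θ) = μ.prod μ)
    (hS : ∀ L ∈ S, ∀ M ∈ S, 0 ≤ ∫ x, L x * M x ∂μ)
    (hcube : Integrable (fun x => ‖x‖ ^ 3) μ) (hsq : ∀ L M : StrongDual ℝ E,
      Integrable (fun x => L x * M x) μ) {θ : ℝ} (hθ : 0 ≤ Real.sin θ)
    (hθ' : 0 ≤ Real.cos (2 * θ)) (n : ℕ) :
    ∫ p, f p.1 * g ((Real.cos (2 * θ) ^ n) • p.1 + √(1 - (Real.cos (2 * θ) ^ n) ^ 2) • p.2)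
        ∂(μ.prod μ) ≤
      ∫ x, f x * g x ∂μ + n * (4 * K * K' * Real.sin θ ^ 3 * ∫ x, ‖x‖ ^ 3 ∂μ) := by
  induction n with
  | zero => simp [integral_prod_fst fun x => f x * g x]
  | succ n ih =>
    have := integral_mul_correlated_le hf hg hK hK' hrot hS hcube hsq hθ
      (pow_nonneg hθ' n) (pow_le_one₀ hθ' (Real.cos_le_one _))
    rw [← pow_succ] at this
    push_cast
    linarith

/-- Smooth monotone functions are positively correlated under a rotation invariant measure with
nonnegative covariances along the cone of monotonicity. -/
lemma integral_mul_integral_le (hf : SmoothConeMonotone S K f)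
    (hg : SmoothConeMonotone S K' g) (hK : 0 ≤ K) (hK' : 0 ≤ K')
    (hrot : ∀ θ, (μ.prod μ).map (ContinuousLinearMap.rotation θ) = μ.prod μ)
    (hS : ∀ L ∈ S, ∀ M ∈ S, 0 ≤ ∫ x, L x * M x ∂μ)
    (hcube : Integrable (fun x => ‖x‖ ^ 3) μ) (hsq : ∀ L M : StrongDual ℝ E,
      Integrable (fun x => L x * M x) μ) :
    (∫ x, f x ∂μ) * ∫ x, g x ∂μ ≤ ∫ x, f x * g x ∂μ := by
  have hfc := hf.continuous
  have hgc := hg.continuous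
  set A : ℝ → ℝ := fun ρ => ∫ p, f p.1 * g (ρ • p.1 + √(1 - ρ ^ 2) • p.2) ∂(μ.prod μ) with hA
  have hAc : Continuous A := by
    refine continuous_of_dominated (bound := fun _ => 1)
      (fun ρ => (Continuous.measurable (by fun_prop)).aestronglyMeasurable)
      (fun ρ => ae_of_all _ fun p => ?_) (integrable_const _) (ae_of_all _ fun p => by fun_prop)
    rw [Real.norm_eq_abs, abs_mul]
    exact mul_le_one₀ (hf.abs_le_one _) (abs_nonneg _) (hg.abs_le_one _)
  have hA0 : A 0 = (∫ x, f x ∂μ) * ∫ x, g x ∂μ := by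
    simp [hA, integral_prod_mul f g]
  set ρ : ℕ → ℝ := fun k => (1 - 2 * (1 / (k : ℝ) ^ 2) ^ 2) ^ (k ^ 5) with hρ
  have hk4 : ∀ k : ℕ, 2 ≤ k → 0 ≤ 1 - 2 * (1 / (k : ℝ) ^ 2) ^ 2 := by
    intro k hk
    have hk' : (2 : ℝ) ≤ k := by exact_mod_cast hk
    have h1 : 1 / (k : ℝ) ^ 2 ≤ 1 / 4 := one_div_le_one_div_of_le (by norm_num) (by nlinarith)
    have h2 : 0 ≤ 1 / (k : ℝ) ^ 2 := by positivity
    nlinarith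
  have hρ0 : Tendsto ρ atTop (𝓝 0) := by
    have hexp : Tendsto (fun k : ℕ => Real.exp (-(k : ℝ))) atTop (𝓝 0) :=
      Real.tendsto_exp_neg_atTop_nhds_zero.comp tendsto_natCast_atTop_atTop
    refine squeeze_zero' ?_ ?_ hexp
    · filter_upwards [eventually_ge_atTop 2] with k hk using pow_nonneg (hk4 k hk) _
    · filter_upwards [eventually_ge_atTop 2] with k hk
      have hk' : (2 : ℝ) ≤ k := by exact_mod_cast hk
      refine (pow_le_pow_left₀ (hk4 k hk) (Real.one_sub_le_exp_neg _) _).trans ?_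
      rw [← Real.exp_nat_mul, Real.exp_le_exp]
      push_cast
      have : (k : ℝ) ^ 5 * -(2 * (1 / (k : ℝ) ^ 2) ^ 2) = -(2 * k) := by field_simp
      rw [this]
      linarith
  set C := 4 * K * K' * ∫ x, ‖x‖ ^ 3 ∂μ with hC
  have hlim : Tendsto (fun k : ℕ => ∫ x, f x * g x ∂μ + C * (1 / (k : ℝ))) atTop
      (𝓝 (∫ x, f x * g x ∂μ + C * 0)) :=
    (tendsto_one_div_atTop_nhds_zero_nat.const_mul C).const_add _
  rw [mul_zero, add_zero] at hlim
  have hAlim : Tendsto (fun k => A (ρ k)) atTop (𝓝 (A 0)) := (hAc.tendsto 0).comp hρ0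
  rw [← hA0]
  refine le_of_tendsto_of_tendsto hAlim hlim ?_
  filter_upwards [eventually_ge_atTop 2] with k hk
  have hk' : (2 : ℝ) ≤ k := by exact_mod_cast hk
  have hs0 : 0 ≤ 1 / (k : ℝ) ^ 2 := by positivity
  have hs1 : 1 / (k : ℝ) ^ 2 ≤ 1 := by
    rw [div_le_one (by positivity)]
    nlinarith
  have hsin : Real.sin (Real.arcsin (1 / (k : ℝ) ^ 2)) = 1 / (k : ℝ) ^ 2 :=
    Real.sin_arcsin (by linarith) hs1
  have hcos : Real.cos (2 * Real.arcsin (1 / (k : ℝ) ^ 2)) = 1 - 2 * (1 / (k : ℝ) ^ 2) ^ 2 := by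
    rw [Real.cos_two_mul', Real.cos_sq', hsin]
    ring
  have := integral_mul_correlated_pow_le hf hg hK hK' hrot hS hcube hsq
    (θ := Real.arcsin (1 / (k : ℝ) ^ 2)) (by rw [hsin]; exact hs0)
    (by rw [hcos]; exact hk4 k hk) (k ^ 5)
  rw [hsin, hcos] at this
  refine this.trans (le_of_eq ?_)
  rw [hC]
  push_cast
  field_simp

end Measure

/-- A set whose indicator is a pointwise limit of smooth functions that are monotone along `S`. -/
def ConeMonotoneSet (S : PointedCone ℝ (StrongDual ℝ E)) (A : Set E) : Prop :=
  ∃ f : ℕ → E → ℝ, (∀ n, ∃ K, 0 ≤ K ∧ SmoothConeMonotone S K (f n)) ∧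
    ∀ x, Tendsto (fun n => f n x) atTop (𝓝 (A.indicator 1 x))

namespace ConeMonotoneSet

variable {S : PointedCone ℝ (StrongDual ℝ E)} {A B : Set E}

lemma univ : ConeMonotoneSet S (Set.univ : Set E) :=
  ⟨fun _ _ => 1, fun _ => ⟨0, le_rfl, .const_one⟩, fun x => by simp⟩

lemma inter (hA : ConeMonotoneSet S A) (hB : ConeMonotoneSet S B) : ConeMonotoneSet S (A ∩ B) := by
  obtain ⟨f, hf, hfl⟩ := hA
  obtain ⟨g, hg, hgl⟩ := hB
  refine ⟨fun n x => f n x * g n x, fun n => ?_, fun x => ?_⟩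
  · obtain ⟨K, hK, hfK⟩ := hf n
    obtain ⟨K', hK', hgK⟩ := hg n
    exact ⟨_, by positivity, hfK.mul hgK hK hK'⟩
  · rw [Set.inter_indicator_one]
    exact (hfl x).mul (hgl x)

lemma forall_mem_finset {κ : Type*} {A : κ → Set E} (s : Finset κ)
    (hA : ∀ k ∈ s, ConeMonotoneSet S (A k)) : ConeMonotoneSet S {x | ∀ k ∈ s, x ∈ A k} := by
  classical
  induction s using Finset.induction_on with
  | empty => simpa using univ
  | insert k s hk ih =>
    have : {x | ∀ j ∈ insert k s, x ∈ A j} = A k ∩ {x | ∀ j ∈ s, x ∈ A j} := by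
      ext x; simp
    rw [this]
    exact (hA k (by simp)).inter (ih fun j hj => hA j (by simp [hj]))

lemma halfspace {L : StrongDual ℝ E} (hL : L ∈ S) (u : ℝ) : ConeMonotoneSet S {x | u ≤ L x} := by
  refine ⟨fun n x => Real.sigmoid ((((n : ℝ) ^ 2) • L) x + (n - (n : ℝ) ^ 2 * u)),
    fun n => ⟨_, by positivity, .sigmoid (S.smul_mem (by positivity) hL) _⟩, fun x => ?_⟩
  have hn : Tendsto (fun n : ℕ => (n : ℝ)) atTop atTop := tendsto_natCast_atTop_atTop
  have e : ∀ n : ℕ, (((n : ℝ) ^ 2) • L) x + (n - (n : ℝ) ^ 2 * u) =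
      n * (n * (L x - u) + 1) := by
    intro n
    rw [smul_apply, smul_eq_mul]
    ring
  simp only [e]
  by_cases h : u ≤ L x
  · rw [Set.indicator_of_mem (by exact h)]
    refine Real.tendsto_sigmoid_atTop.comp (tendsto_atTop_mono (fun n => ?_) hn)
    have h1 : (0 : ℝ) ≤ n := Nat.cast_nonneg n
    have := mul_nonneg h1 (mul_nonneg h1 (sub_nonneg.2 h))
    linarith
  · rw [Set.indicator_of_notMem (by exact h)]
    refine Real.tendsto_sigmoid_atBot.comp (hn.atTop_mul_atBot₀ ?_)
    exact tendsto_atBot_add_const_right _ _ (hn.atTop_mul_const_of_neg (by linarith [not_le.1 h]))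

lemma measureReal_mul_le [MeasurableSpace E] [BorelSpace E] [SecondCountableTopology E]
    {μ : Measure E} [IsProbabilityMeasure μ]
    (hA : ConeMonotoneSet S A) (hB : ConeMonotoneSet S B)
    (hAm : MeasurableSet A) (hBm : MeasurableSet B)
    (hrot : ∀ θ, (μ.prod μ).map (ContinuousLinearMap.rotation θ) = μ.prod μ)
    (hS : ∀ L ∈ S, ∀ M ∈ S, 0 ≤ ∫ x, L x * M x ∂μ)
    (hcube : Integrable (fun x => ‖x‖ ^ 3) μ) (hsq : ∀ L M : StrongDual ℝ E,
      Integrable (fun x => L x * M x) μ) :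
    μ.real A * μ.real B ≤ μ.real (A ∩ B) := by
  have lim : ∀ {C : Set E} {f : ℕ → E → ℝ}, MeasurableSet C →
      (∀ n, ∃ K, 0 ≤ K ∧ SmoothConeMonotone S K (f n)) →
      (∀ x, Tendsto (fun n => f n x) atTop (𝓝 (C.indicator 1 x))) →
      Tendsto (fun n => ∫ x, f n x ∂μ) atTop (𝓝 (μ.real C)) := by
    intro C f hC hf hl
    rw [← integral_indicator_one hC]
    refine tendsto_integral_of_dominated_convergence (fun _ => 1) (fun n => ?_)
      (integrable_const _) (fun n => ae_of_all _ fun x => ?_) (ae_of_all _ hl)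
    · obtain ⟨K, -, h⟩ := hf n
      exact h.continuous.measurable.aestronglyMeasurable
    · obtain ⟨K, -, h⟩ := hf n
      exact h.abs_le_one x
  obtain ⟨f, hf, hfl⟩ := hA
  obtain ⟨g, hg, hgl⟩ := hB
  have hfg := lim (hAm.inter hBm) (f := fun n x => f n x * g n x)
    (fun n => by
      obtain ⟨K, hK, hfK⟩ := hf n
      obtain ⟨K', hK', hgK⟩ := hg n
      exact ⟨_, by positivity, hfK.mul hgK hK hK'⟩)
    (fun x => by
      rw [Set.inter_indicator_one]
      exact (hfl x).mul (hgl x))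
  refine le_of_tendsto_of_tendsto' ((lim hAm hf hfl).mul (lim hBm hg hgl)) hfg fun n => ?_
  obtain ⟨K, hK, hfK⟩ := hf n
  obtain ⟨K', hK', hgK⟩ := hg n
  exact integral_mul_integral_le hfK hgK hK hK' hrot hS hcube hsq

end ConeMonotoneSet

end Association

section Coordinates

variable {ι : Type*} [Fintype ι] [DecidableEq ι]

/-- The cone of continuous linear functionals with nonpositive coordinates. -/
def nonposCone (ι : Type*) [Fintype ι] [DecidableEq ι] :
    PointedCone ℝ (StrongDual ℝ (ι → ℝ)) where
  carrier := {L | ∀ i, L (Pi.single i 1) ≤ 0}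
  add_mem' hL hM i := add_nonpos (hL i) (hM i)
  zero_mem' _ := le_rfl
  smul_mem' c _ hL i := mul_nonpos_of_nonneg_of_nonpos c.2 (hL i)

lemma strongDual_pi_apply (L : StrongDual ℝ (ι → ℝ)) (x : ι → ℝ) :
    L x = ∑ i, L (Pi.single i 1) * x i := by
  conv_lhs => rw [pi_eq_sum_univ' x]
  rw [map_sum]
  refine Finset.sum_congr rfl fun i _ => ?_
  rw [map_smul, smul_eq_mul, mul_comm]

lemma coneMonotoneSet_sum_le {a : ι → ℝ} (ha : ∀ i, 0 ≤ a i) (u : ℝ) :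
    ConeMonotoneSet (nonposCone ι) {x | ∑ i, a i * x i ≤ u} := by
  set L : StrongDual ℝ (ι → ℝ) := -∑ i, a i • ContinuousLinearMap.proj i with hL
  have hLx : ∀ x, L x = -∑ i, a i * x i := fun x => by simp [hL]
  have hmem : L ∈ nonposCone ι := fun i => by
    rw [hLx]
    simpa [Pi.single_apply] using ha i
  have := ConeMonotoneSet.halfspace hmem (-u)
  simpa [hLx] using this

lemma integral_strongDual_pi_mul {μ : Measure (ι → ℝ)}
    (hprod : ∀ i j, Integrable (fun x : ι → ℝ => x i * x j) μ) (L M : StrongDual ℝ (ι → ℝ)) :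
    ∫ x, L x * M x ∂μ =
      ∑ i, ∑ j, L (Pi.single i 1) * M (Pi.single j 1) * ∫ x, x i * x j ∂μ := by
  have e : ∀ x : ι → ℝ, L x * M x =
      ∑ i, ∑ j, L (Pi.single i 1) * M (Pi.single j 1) * (x i * x j) := by
    intro x
    rw [strongDual_pi_apply L, strongDual_pi_apply M, Finset.sum_mul_sum]
    exact Finset.sum_congr rfl fun i _ => Finset.sum_congr rfl fun j _ => by ring
  simp only [e]
  rw [integral_finsetSum _ fun i _ => integrable_finsetSum _ fun j _ => (hprod i j).const_mul _]
  refine Finset.sum_congr rfl fun i _ => ?_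
  rw [integral_finsetSum _ fun j _ => (hprod i j).const_mul _]
  exact Finset.sum_congr rfl fun j _ => integral_const_mul _ _

/-- Gaussian vectors with nonnegative covariances are associated. -/
lemma gaussian_measureReal_mul_le {μ : Measure (ι → ℝ)} [IsGaussian μ]
    (hmean : ∫ x, x ∂μ = 0) (hcov : ∀ i j, 0 ≤ ∫ x, x i * x j ∂μ) {A B : Set (ι → ℝ)}
    (hA : ConeMonotoneSet (nonposCone ι) A) (hB : ConeMonotoneSet (nonposCone ι) B)
    (hAm : MeasurableSet A) (hBm : MeasurableSet B) :
    μ.real A * μ.real B ≤ μ.real (A ∩ B) := by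
  have hsq : ∀ L M : StrongDual ℝ (ι → ℝ), Integrable (fun x => L x * M x) μ := fun L M =>
    (IsGaussian.memLp_dual μ L 2 (by simp)).integrable_mul (IsGaussian.memLp_dual μ M 2 (by simp))
  refine hA.measureReal_mul_le hB hAm hBm (IsGaussian.map_rotation_eq_self hmean)
    (fun L hL M hM => ?_) ?_ hsq
  · rw [integral_strongDual_pi_mul fun i j =>
      hsq (ContinuousLinearMap.proj i) (ContinuousLinearMap.proj j)]
    exact Finset.sum_nonneg fun i _ => Finset.sum_nonneg fun j _ =>
      mul_nonneg (mul_nonneg_of_nonpos_of_nonpos (hL i) (hM j)) (hcov i j)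
  · exact (IsGaussian.memLp_id μ 3 (by simp)).integrable_norm_pow (by norm_num)

/-- A centered Gaussian measure on a finite product of lines is determined by its covariances. -/
lemma gaussian_ext_of_covariance {μ ν : Measure (ι → ℝ)} [IsGaussian μ] [IsGaussian ν]
    (hμ : ∫ x, x ∂μ = 0) (hν : ∫ x, x ∂ν = 0)
    (h : ∀ i j, ∫ x, x i * x j ∂μ = ∫ x, x i * x j ∂ν) : μ = ν := by
  refine Measure.ext_of_charFunDual ?_
  ext L
  rw [IsGaussian.charFunDual_eq_of_integral_eq_zero hμ,
    IsGaussian.charFunDual_eq_of_integral_eq_zero hν]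
  have key : ∀ (ξ : Measure (ι → ℝ)) [IsGaussian ξ], ∫ x, x ∂ξ = 0 → Var[L; ξ] =
      ∑ i, ∑ j, L (Pi.single i 1) * L (Pi.single j 1) * ∫ x, x i * x j ∂ξ := by
    intro ξ _ hξ
    rw [← integral_strongDual_pi_mul fun i j =>
      (IsGaussian.memLp_dual ξ (ContinuousLinearMap.proj i) 2 (by simp)).integrable_mul
        (IsGaussian.memLp_dual ξ (ContinuousLinearMap.proj j) 2 (by simp)),
      variance_of_integral_eq_zero (by fun_prop)
        (by rw [IsGaussian.integral_dual, hξ, map_zero])]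
    simp only [sq]
  rw [key μ hμ, key ν hν]
  simp only [h]

end Coordinates

section GaussianSequence

/-- A centered Gaussian sequence `X 1, X 2, …` with covariances `E[X k * X (k + j)] = r j`, which
are nonnegative and satisfy `r 0 = 1`. -/
structure IsPosStationaryGaussian {Ω : Type*} [MeasurableSpace Ω] (P : Measure Ω)
    (X : ℕ → Ω → ℝ) (r : ℕ → ℝ) : Prop where
  measurable : ∀ i, Measurable (X i)
  gauss : ∀ s : Finset ℕ, (∀ i ∈ s, 1 ≤ i) → ∀ c : ℕ → ℝ,
    ∃ v : NNReal, Measure.map (fun ω => ∑ i ∈ s, c i * X i ω) P = gaussianReal 0 v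
  cov_nonneg : ∀ j, 0 ≤ r j
  cov_zero : r 0 = 1
  cov_add : ∀ k, 1 ≤ k → ∀ j, ∫ ω, X k ω * X (k + j) ω ∂P = r j

/-- The set of vectors whose increments of partial sums from `l` to `k`, `k ∈ K`, are at most
`b`. -/
def partialSumsLE (n l : ℕ) (K : Finset ℕ) (b : ℝ) : Set (Fin n → ℝ) :=
  {y | ∀ k ∈ K, y ∈ {y : Fin n → ℝ | ∑ i : Fin n, (if l ≤ i ∧ i < k then 1 else 0) * y i ≤ b}}

lemma coneMonotoneSet_partialSumsLE (n l : ℕ) (K : Finset ℕ) (b : ℝ) :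
    ConeMonotoneSet (nonposCone (Fin n)) (partialSumsLE n l K b) :=
  .forall_mem_finset K fun k _ => coneMonotoneSet_sum_le (fun i => by split_ifs <;> simp) b

lemma measurableSet_partialSumsLE (n l : ℕ) (K : Finset ℕ) (b : ℝ) :
    MeasurableSet (partialSumsLE n l K b) := by
  have : partialSumsLE n l K b = ⋂ k ∈ K,
      {y : Fin n → ℝ | ∑ i : Fin n, (if l ≤ i ∧ i < k then 1 else 0) * y i ≤ b} := by
    ext
    simp [partialSumsLE]
  rw [this]
  exact Finset.measurableSet_biInter K fun k _ => measurableSet_le (by fun_prop) (by fun_prop)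

lemma mem_partialSumsLE {n l : ℕ} {K : Finset ℕ} {b : ℝ} (hK : ∀ k ∈ K, k ≤ n) (f : ℕ → ℝ) :
    (fun i : Fin n => f i) ∈ partialSumsLE n l K b ↔ ∀ k ∈ K, ∑ i ∈ Finset.Ico l k, f i ≤ b := by
  have : ∀ k ≤ n, ∑ i : Fin n, (if l ≤ (i : ℕ) ∧ (i : ℕ) < k then (1 : ℝ) else 0) * f i =
      ∑ i ∈ Finset.Ico l k, f i := by
    intro k hk
    rw [Fin.sum_univ_eq_sum_range (fun i => (if l ≤ i ∧ i < k then (1 : ℝ) else 0) * f i) n]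
    simp only [ite_mul, one_mul, zero_mul]
    rw [← Finset.sum_filter]
    refine Finset.sum_congr ?_ fun _ _ => rfl
    ext i
    simp only [Finset.mem_filter, Finset.mem_range, Finset.mem_Ico]
    omega
  refine forall₂_congr fun k hk => ?_
  rw [Set.mem_ofPred_eq, this k (hK k hk)]

namespace IsPosStationaryGaussian

variable {Ω : Type*} [MeasurableSpace Ω] {P : Measure Ω}
  {X : ℕ → Ω → ℝ} {r : ℕ → ℝ}

lemma exists_map_sum_eq_gaussianReal (h : IsPosStationaryGaussian P X r) {ι : Type*} [Fintype ι]
    {σ : ι → ℕ} (hσ : ∀ i, 1 ≤ σ i) (c : ι → ℝ) :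
    ∃ v : NNReal, P.map (fun ω => ∑ i, c i * X (σ i) ω) = gaussianReal 0 v := by
  classical
  obtain ⟨v, hv⟩ := h.gauss (Finset.univ.image σ) (by simpa using hσ)
    (fun j => ∑ i with σ i = j, c i)
  refine ⟨v, ?_⟩
  rw [← hv]
  congr 1
  ext ω
  rw [← Finset.sum_fiberwise_of_maps_to (t := Finset.univ.image σ) (g := σ) (by simp)]
  refine Finset.sum_congr rfl fun j _ => ?_
  rw [Finset.sum_mul]
  refine Finset.sum_congr rfl fun i hi => ?_
  rw [(Finset.mem_filter.1 hi).2]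

lemma integral_mul (h : IsPosStationaryGaussian P X r) {k l : ℕ} (hk : 1 ≤ k) (hl : 1 ≤ l) :
    ∫ ω, X k ω * X l ω ∂P = r (Nat.dist k l) := by
  rcases le_total k l with hkl | hkl
  · rw [Nat.dist_eq_sub_of_le hkl, ← h.cov_add k hk, Nat.add_sub_cancel' hkl]
  · rw [Nat.dist_eq_sub_of_le_right hkl, ← h.cov_add l hl, Nat.add_sub_cancel' hkl]
    simp only [mul_comm]

lemma integral_mul_nonneg (h : IsPosStationaryGaussian P X r) {k l : ℕ} (hk : 1 ≤ k)
    (hl : 1 ≤ l) : 0 ≤ ∫ ω, X k ω * X l ω ∂P :=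
  h.integral_mul hk hl ▸ h.cov_nonneg _

lemma memLp_two (h : IsPosStationaryGaussian P X r) {k : ℕ} (hk : 1 ≤ k) : MemLp (X k) 2 P := by
  obtain ⟨v, hv⟩ := h.gauss {k} (by simpa using hk) 1
  have hid : MemLp id 2 (P.map (X k)) := by
    have : P.map (X k) = gaussianReal 0 v := by simpa using hv
    rw [this]
    exact memLp_id_gaussianReal 2
  exact (memLp_map_measure_iff aestronglyMeasurable_id (h.measurable k).aemeasurable).1 hid

lemma le_integral_sq_partialSum (h : IsPosStationaryGaussian P X r) (m : ℕ) :
    (m : ℝ) ≤ ∫ ω, (∑ i ∈ Finset.range m, X (i + 1) ω) ^ 2 ∂P := by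
  have hprod : ∀ i j, Integrable (fun ω => X (i + 1) ω * X (j + 1) ω) P := fun i j =>
    (h.memLp_two (by omega)).integrable_mul (h.memLp_two (by omega))
  simp only [sq, Finset.sum_mul_sum]
  rw [integral_finsetSum _ fun i _ => integrable_finsetSum _ fun j _ => hprod i j]
  calc (m : ℝ) = ∑ i ∈ Finset.range m, ∫ ω, X (i + 1) ω * X (i + 1) ω ∂P := by
        simp [h.integral_mul, Nat.dist_self, h.cov_zero]
    _ ≤ _ := Finset.sum_le_sum fun i hi => by
        rw [integral_finsetSum _ fun j _ => hprod i j]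
        exact Finset.single_le_sum
          (f := fun j => ∫ ω, X (i + 1) ω * X (j + 1) ω ∂P)
          (fun j _ => h.integral_mul_nonneg (by omega) (by omega)) hi

section Vector

variable {ι : Type*} {σ : ι → ℕ} (a : ℝ)

lemma measurable_vector (h : IsPosStationaryGaussian P X r) :
    Measurable fun ω i => a * X (σ i) ω :=
  measurable_pi_lambda _ fun i => (h.measurable (σ i)).const_mul a

variable [Fintype ι]

lemma exists_map_vector_dual (h : IsPosStationaryGaussian P X r) (hσ : ∀ i, 1 ≤ σ i)
    (L : StrongDual ℝ (ι → ℝ)) :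
    ∃ v : NNReal, (P.map fun ω i => a * X (σ i) ω).map L = gaussianReal 0 v := by
  classical
  obtain ⟨v, hv⟩ := h.exists_map_sum_eq_gaussianReal hσ fun i => L (Pi.single i 1) * a
  refine ⟨v, ?_⟩
  rw [Measure.map_map (by fun_prop) (h.measurable_vector a), ← hv]
  congr 1
  ext ω
  simp only [Function.comp_apply]
  rw [strongDual_pi_apply]
  simp only [mul_assoc]

lemma isGaussian_vector (h : IsPosStationaryGaussian P X r) (hσ : ∀ i, 1 ≤ σ i) :
    IsGaussian (P.map fun ω i => a * X (σ i) ω) :=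
  isGaussian_of_map_eq_gaussianReal fun L => ⟨0, h.exists_map_vector_dual a hσ L⟩

lemma integral_vector (h : IsPosStationaryGaussian P X r) (hσ : ∀ i, 1 ≤ σ i) :
    ∫ x, x ∂(P.map fun ω i => a * X (σ i) ω) = 0 := by
  have := h.isGaussian_vector a hσ
  ext i
  obtain ⟨v, hv⟩ := h.exists_map_vector_dual a hσ (ContinuousLinearMap.proj i)
  have e := IsGaussian.integral_dual (μ := P.map fun ω i => a * X (σ i) ω)
    (ContinuousLinearMap.proj i)
  have e' := integral_map (μ := P.map fun ω i => a * X (σ i) ω) (f := fun x : ℝ => x)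
    (φ := (ContinuousLinearMap.proj i : StrongDual ℝ (ι → ℝ)))
    (by fun_prop) (by fun_prop)
  rw [hv, integral_id_gaussianReal] at e'
  rw [← e'] at e
  exact e.symm

lemma integral_vector_mul (h : IsPosStationaryGaussian P X r) (hσ : ∀ i, 1 ≤ σ i) (i j : ι) :
    ∫ x, x i * x j ∂(P.map fun ω i => a * X (σ i) ω) = a * a * r (Nat.dist (σ i) (σ j)) := by
  rw [integral_map (h.measurable_vector a).aemeasurable (by fun_prop),
    ← h.integral_mul (hσ i) (hσ j),
    ← integral_const_mul]
  congr 1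
  ext ω
  ring

end Vector

/-- Invariance of the persistence probabilities under shifts and reflected time reversals. -/
lemma measureReal_partialSums_eq (h : IsPosStationaryGaussian P X r) {n : ℕ} {σ : ℕ → ℕ}
    (hσ : ∀ i < n, 1 ≤ σ i)
    (hdist : ∀ i < n, ∀ j < n, Nat.dist (σ i) (σ j) = Nat.dist (i + 1) (j + 1))
    {a : ℝ} (ha : a * a = 1) (b : ℝ) :
    P.real {ω | ∀ k ∈ Finset.Icc 1 n, ∑ i ∈ Finset.range k, a * X (σ i) ω ≤ b} =
      P.real {ω | ∀ k ∈ Finset.Icc 1 n, ∑ i ∈ Finset.range k, X (i + 1) ω ≤ b} := by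
  have hσ' : ∀ i : Fin n, 1 ≤ σ i := fun i => hσ i i.2
  have := h.isGaussian_vector a hσ'
  have hs : ∀ i : Fin n, 1 ≤ (i : ℕ) + 1 := fun i => by omega
  have := h.isGaussian_vector 1 hs
  have hlaw := gaussian_ext_of_covariance (h.integral_vector a hσ') (h.integral_vector 1 hs)
    fun i j => by
      rw [h.integral_vector_mul a hσ', h.integral_vector_mul 1 hs, hdist i i.2 j j.2, ha,
        mul_one, one_mul]
  have hm := measurableSet_partialSumsLE n 0 (Finset.Icc 1 n) b
  have key := congrArg (fun μ => μ.real (partialSumsLE n 0 (Finset.Icc 1 n) b)) hlaw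
  rw [map_measureReal_apply (h.measurable_vector a) hm,
    map_measureReal_apply (h.measurable_vector 1) hm] at key
  have hK : ∀ k ∈ Finset.Icc 1 n, k ≤ n := fun k hk => (Finset.mem_Icc.1 hk).2
  convert key using 2
  · ext ω
    rw [Set.mem_preimage, mem_partialSumsLE hK fun i => a * X (σ i) ω]
    simp
  · ext ω
    rw [Set.mem_preimage, mem_partialSumsLE hK fun i => 1 * X (i + 1) ω]
    simp

/-- At a time `m ≥ b²` the walk is below `-b` with probability bounded below. -/
lemma le_measureReal_partialSum_le_neg (h : IsPosStationaryGaussian P X r) {m : ℕ} {b : ℝ}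
    (hb : b ^ 2 ≤ m) :
    (gaussianReal 0 1).real (Set.Iic (-1)) ≤
      P.real {ω | ∑ i ∈ Finset.range m, X (i + 1) ω ≤ -b} := by
  have hmeas : Measurable fun ω => ∑ i ∈ Finset.range m, X (i + 1) ω :=
    Finset.measurable_fun_sum _ fun i _ => h.measurable _
  obtain ⟨v, hv⟩ := h.exists_map_sum_eq_gaussianReal (σ := fun i : Fin m => (i : ℕ) + 1)
    (fun i => by omega) 1
  have hv : P.map (fun ω => ∑ i ∈ Finset.range m, X (i + 1) ω) = gaussianReal 0 v := by
    rw [← hv]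
    congr 1
    ext ω
    simp [Fin.sum_univ_eq_sum_range (fun i => X (i + 1) ω)]
  have hvar : (m : ℝ) ≤ v := by
    refine (h.le_integral_sq_partialSum m).trans_eq ?_
    rw [← variance_fun_id_gaussianReal (μ := 0) (v := v),
      variance_of_integral_eq_zero (by fun_prop) (by simp), ← hv,
      integral_map hmeas.aemeasurable (by fun_prop)]
  have hscale : gaussianReal 0 v = (gaussianReal 0 1).map (√v * ·) := by
    rw [gaussianReal_map_const_mul]
    congr 1
    · simp
    · ext
      simp
  have hb' : b ≤ √v := Real.le_sqrt_of_sq_le (hb.trans hvar)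
  have : P.real {ω | ∑ i ∈ Finset.range m, X (i + 1) ω ≤ -b} =
      (gaussianReal 0 1).real ((√v * ·) ⁻¹' Set.Iic (-b)) := by
    rw [← map_measureReal_apply (by fun_prop) measurableSet_Iic, ← hscale, ← hv,
      map_measureReal_apply hmeas measurableSet_Iic]
    rfl
  rw [this]
  refine measureReal_mono fun x hx => ?_
  simp only [Set.mem_Iic, Set.mem_preimage] at hx ⊢
  nlinarith [Real.sqrt_nonneg (v : ℝ)]

variable [IsProbabilityMeasure P]

/-- The walk stays nonpositive up to time `n` with probability at least `1 / (2 n + 1)`. -/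
lemma one_le_mul_measureReal_partialSums_nonpos (h : IsPosStationaryGaussian P X r) (n : ℕ) :
    1 ≤ (2 * n + 1) *
      P.real {ω | ∀ k ∈ Finset.Icc 1 n, ∑ i ∈ Finset.range k, X (i + 1) ω ≤ 0} := by
  set p := P.real {ω | ∀ k ∈ Finset.Icc 1 n, ∑ i ∈ Finset.range k, X (i + 1) ω ≤ 0} with hp
  set S : ℕ → Ω → ℝ := fun k ω => ∑ i ∈ Finset.range k, X (i + 1) ω with hS
  let A : ℕ → Set Ω := fun j => {ω | ∀ k ∈ Finset.range (2 * n + 1), S k ω ≤ S j ω}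
  have hcover : (Set.univ : Set Ω) ⊆ ⋃ j ∈ Finset.range (2 * n + 1), A j := fun ω _ => by
    obtain ⟨j, hj, hmax⟩ := (Finset.range (2 * n + 1)).exists_max_image (fun k => S k ω) (by simp)
    exact Set.mem_biUnion (Finset.mem_coe.2 hj) hmax
  have hbound : ∀ j ∈ Finset.range (2 * n + 1), P.real (A j) ≤ p := by
    intro j hj
    rw [Finset.mem_range] at hj
    rcases le_total j n with hjn | hjn
    · rw [hp, ← h.measureReal_partialSums_eq (σ := fun i => j + i + 1) (a := 1) (by simp)
        (fun i _ k _ => by simp only [Nat.dist]; omega) (by simp) 0]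
      refine measureReal_mono fun ω hω k hk => ?_
      rw [Finset.mem_Icc] at hk
      have hle := hω (j + k) (by rw [Finset.mem_range]; omega)
      simp only [hS, Finset.sum_range_add] at hle
      simp only [one_mul]
      linarith
    · rw [hp, ← h.measureReal_partialSums_eq (σ := fun i => j - i) (a := -1)
        (fun i _ => by omega)
        (fun i _ k _ => by simp only [Nat.dist]; omega) (by simp) 0]
      refine measureReal_mono fun ω hω k hk => ?_
      rw [Finset.mem_Icc] at hk
      have hle := hω (j - k) (by rw [Finset.mem_range]; omega)
      have hsplit : S j ω = S (j - k) ω + ∑ i ∈ Finset.range k, X (j - i) ω := by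
        conv_lhs => rw [← Nat.sub_add_cancel (hk.2.trans hjn)]
        simp only [hS, Finset.sum_range_add]
        rw [← Finset.sum_range_reflect (fun i => X (j - i) ω)]
        congr 1
        refine Finset.sum_congr rfl fun i hi => ?_
        rw [Finset.mem_range] at hi
        congr 1
        omega
      simp only [neg_mul, one_mul, Finset.sum_neg_distrib]
      linarith
  calc (1 : ℝ) = P.real Set.univ := by simp
    _ ≤ P.real (⋃ j ∈ Finset.range (2 * n + 1), A j) :=
      measureReal_mono hcover (measure_ne_top _ _)
    _ ≤ ∑ j ∈ Finset.range (2 * n + 1), P.real (A j) := measureReal_biUnion_finset_le _ _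
    _ ≤ ∑ _j ∈ Finset.range (2 * n + 1), p := Finset.sum_le_sum hbound
    _ = (2 * n + 1) * p := by simp

/-- Persistence below `0` up to time `T` follows from persistence below `0` up to time `m`, a low
value at time `m`, and bounded increments after time `m`. -/
lemma measureReal_partialSums_mul_le (h : IsPosStationaryGaussian P X r) (m T : ℕ) (b : ℝ) :
    P.real {ω | ∀ k ∈ Finset.Icc 1 m, ∑ i ∈ Finset.range k, X (i + 1) ω ≤ 0} *
      P.real {ω | ∑ i ∈ Finset.range m, X (i + 1) ω ≤ -b} *
      P.real {ω | ∀ k ∈ Finset.Icc 1 T, ∑ i ∈ Finset.range k, X (i + 1) ω ≤ b} ≤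
    P.real {ω | ∀ k ∈ Finset.Icc 1 T, ∑ i ∈ Finset.range k, X (i + 1) ω ≤ 0} := by
  have hs : ∀ i : Fin (m + T), 1 ≤ (i : ℕ) + 1 := fun i => by omega
  have := h.isGaussian_vector 1 hs
  set Y : Ω → Fin (m + T) → ℝ := fun ω i => 1 * X ((i : ℕ) + 1) ω with hY
  have hYm : Measurable Y := h.measurable_vector 1
  have hmem : ∀ {l : ℕ} {K : Finset ℕ} {u : ℝ}, (∀ k ∈ K, k ≤ m + T) → ∀ ω,
      Y ω ∈ partialSumsLE (m + T) l K u ↔ ∀ k ∈ K, ∑ i ∈ Finset.Ico l k, X (i + 1) ω ≤ u := by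
    intro l K u hK ω
    simpa [hY] using mem_partialSumsLE hK (fun i => 1 * X (i + 1) ω)
  have hassoc : ∀ {A B : Set (Fin (m + T) → ℝ)}, ConeMonotoneSet (nonposCone _) A →
      ConeMonotoneSet (nonposCone _) B → MeasurableSet A → MeasurableSet B →
      P.real (Y ⁻¹' A) * P.real (Y ⁻¹' B) ≤ P.real (Y ⁻¹' (A ∩ B)) := by
    intro A B hA hB hAm hBm
    rw [← map_measureReal_apply hYm hAm, ← map_measureReal_apply hYm hBm,
      ← map_measureReal_apply hYm (hAm.inter hBm)]
    refine gaussian_measureReal_mul_le (h.integral_vector 1 hs) (fun i j => ?_) hA hB hAm hBm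
    rw [h.integral_vector_mul 1 hs]
    simpa using h.cov_nonneg _
  have hK₁ : ∀ k ∈ Finset.Icc 1 m, k ≤ m + T := fun k hk => by rw [Finset.mem_Icc] at hk; omega
  have hK₂ : ∀ k ∈ ({m} : Finset ℕ), k ≤ m + T := by simp
  have hK₃ : ∀ k ∈ Finset.Icc (m + 1) (m + T), k ≤ m + T := fun k hk => (Finset.mem_Icc.1 hk).2
  let A := partialSumsLE (m + T) 0 (Finset.Icc 1 m) 0
  let B := partialSumsLE (m + T) 0 {m} (-b)
  let C := partialSumsLE (m + T) m (Finset.Icc (m + 1) (m + T)) b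
  have cA : ConeMonotoneSet _ A := coneMonotoneSet_partialSumsLE ..
  have cB : ConeMonotoneSet _ B := coneMonotoneSet_partialSumsLE ..
  have cC : ConeMonotoneSet _ C := coneMonotoneSet_partialSumsLE ..
  have mA : MeasurableSet A := measurableSet_partialSumsLE ..
  have mB : MeasurableSet B := measurableSet_partialSumsLE ..
  have mC : MeasurableSet C := measurableSet_partialSumsLE ..
  have eA : {ω | ∀ k ∈ Finset.Icc 1 m, ∑ i ∈ Finset.range k, X (i + 1) ω ≤ 0} = Y ⁻¹' A := by
    ext ω
    rw [Set.mem_preimage, hmem hK₁]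
    simp
  have eB : {ω | ∑ i ∈ Finset.range m, X (i + 1) ω ≤ -b} = Y ⁻¹' B := by
    ext ω
    rw [Set.mem_preimage, hmem hK₂]
    simp
  have eC : P.real {ω | ∀ k ∈ Finset.Icc 1 T, ∑ i ∈ Finset.range k, X (i + 1) ω ≤ b} =
      P.real (Y ⁻¹' C) := by
    rw [← h.measureReal_partialSums_eq (σ := fun i => m + i + 1) (a := 1) (by simp)
      (fun i _ k _ => by simp only [Nat.dist]; omega) (by simp) b]
    congr 1
    ext ω
    rw [Set.mem_preimage, hmem hK₃]
    have hshift : ∀ k, ∑ i ∈ Finset.Ico m (m + k), X (i + 1) ω =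
        ∑ i ∈ Finset.range k, 1 * X (m + i + 1) ω := fun k => by
      rw [Finset.sum_Ico_eq_sum_range]
      simp
    simp only [Set.mem_ofPred_eq, ← hshift]
    refine ⟨fun H k hk => ?_, fun H k hk => H (m + k) ?_⟩
    · rw [Finset.mem_Icc] at hk
      have := H (k - m) (by rw [Finset.mem_Icc]; omega)
      rwa [Nat.add_sub_cancel' (by omega)] at this
    · rw [Finset.mem_Icc] at hk ⊢
      omega
  rw [eA, eB, eC]
  calc _ ≤ P.real (Y ⁻¹' (A ∩ B)) * P.real (Y ⁻¹' C) := by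
        gcongr
        exact hassoc cA cB mA mB
    _ ≤ P.real (Y ⁻¹' (A ∩ B ∩ C)) := hassoc (cA.inter cB) cC (mA.inter mB) mC
    _ ≤ _ := measureReal_mono ?_
  intro ω hω k hk
  obtain ⟨⟨hA, hB⟩, hC⟩ := hω
  replace hA := (hmem hK₁ ω).1 hA
  replace hB := (hmem hK₂ ω).1 hB m (by simp)
  replace hC := (hmem hK₃ ω).1 hC
  simp only [Nat.Ico_zero_eq_range] at hA hB
  rw [Finset.mem_Icc] at hk
  rcases le_or_gt k m with hkm | hkm
  · exact hA k (Finset.mem_Icc.2 ⟨hk.1, hkm⟩)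
  · rw [← Finset.sum_range_add_sum_Ico _ hkm.le]
    linarith [hC k (Finset.mem_Icc.2 ⟨hkm, by omega⟩)]

end IsPosStationaryGaussian

end GaussianSequence

/-- **Statement 11.**
Let `(X_i)_{i ≥ 1}` be a stationary centered Gaussian sequence with `E[X_i²] = 1` and
nonnegative correlations `r j = E[X_k X_{k+j}]` independent of `k`, and let
`Z_n = ∑_{i=1}^n X_i`.  Then for every `β > 0` there are `c > 0` and `T₀` such that for all `T ≥ T₀`,
`P[max_{k=1,…,T} Z_k ≤ β log T] ≤ c (log T)² · P[max_{k=1,…,T} Z_k ≤ 1]`. -/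
theorem stmt18
    {Ω : Type*} [MeasurableSpace Ω] (P : Measure Ω) [IsProbabilityMeasure P]
    (X : ℕ → Ω → ℝ) (hXmeas : ∀ i, Measurable (X i))
    (hgauss : ∀ s : Finset ℕ, (∀ i ∈ s, 1 ≤ i) → ∀ c : ℕ → ℝ,
      ∃ v : NNReal,
        Measure.map (fun ω => ∑ i ∈ s, c i * X i ω) P = gaussianReal 0 v)
    (r : ℕ → ℝ) (hrnonneg : ∀ j, 0 ≤ r j) (hr0 : r 0 = 1)
    (hrcov : ∀ k, 1 ≤ k → ∀ j, ∫ ω, X k ω * X (k + j) ω ∂P = r j)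
    (Z : ℕ → Ω → ℝ) (hZ : ∀ n ω, Z n ω = ∑ i ∈ Finset.Icc 1 n, X i ω) :
    ∀ β > (0 : ℝ), ∃ c > (0 : ℝ), ∃ T₀ : ℕ, ∀ T ≥ T₀,
      (P {ω | ∀ k ∈ Finset.Icc 1 T, Z k ω ≤ β * Real.log T}).toReal ≤
        c * Real.log T ^ 2 *
          (P {ω | ∀ k ∈ Finset.Icc 1 T, Z k ω ≤ 1}).toReal := by
  have h : IsPosStationaryGaussian P X r := ⟨hXmeas, hgauss, hrnonneg, hr0, hrcov⟩
  have hZ' : ∀ k ω, Z k ω = ∑ i ∈ Finset.range k, X (i + 1) ω := fun k ω => by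
    rw [hZ, Finset.range_eq_Ico, Finset.sum_Ico_add' (fun i => X i ω) 0 k 1]
    rfl
  have hq : 0 < (gaussianReal 0 1).real (Set.Iic (-1)) := by
    rw [measureReal_def, ENNReal.toReal_pos_iff]
    refine ⟨pos_iff_ne_zero.2 fun h0 => ?_, measure_lt_top _ _⟩
    simpa using gaussianReal_absolutelyContinuous' 0 one_ne_zero h0
  set q := (gaussianReal 0 1).real (Set.Iic (-1))
  intro β hβ
  refine ⟨(2 * β ^ 2 + 3) / q, by positivity, 3, fun T hT => ?_⟩
  have hlog : 1 ≤ Real.log T := by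
    rw [Real.le_log_iff_exp_le (by positivity)]
    exact Real.exp_one_lt_three.le.trans (by exact_mod_cast hT)
  set b := β * Real.log T with hb
  simp only [hZ', ← measureReal_def]
  set x := P.real {ω | ∀ k ∈ Finset.Icc 1 T, ∑ i ∈ Finset.range k, X (i + 1) ω ≤ b}
  set m := ⌈b ^ 2⌉₊
  have hbm : b ^ 2 ≤ m := Nat.le_ceil _
  have hm : (2 * m + 1 : ℝ) ≤ (2 * β ^ 2 + 3) * Real.log T ^ 2 := by
    have hlt : (m : ℝ) < b ^ 2 + 1 := Nat.ceil_lt_add_one (by positivity)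
    nlinarith
  have hpersist := h.one_le_mul_measureReal_partialSums_nonpos m
  have hlow := h.le_measureReal_partialSum_le_neg hbm
  have hassoc := h.measureReal_partialSums_mul_le m T b
  set p := P.real {ω | ∀ k ∈ Finset.Icc 1 m, ∑ i ∈ Finset.range k, X (i + 1) ω ≤ 0}
  have hp : 0 ≤ p := measureReal_nonneg
  have hx : 0 ≤ x := measureReal_nonneg
  have hmono : P.real {ω | ∀ k ∈ Finset.Icc 1 T, ∑ i ∈ Finset.range k, X (i + 1) ω ≤ 0} ≤
      P.real {ω | ∀ k ∈ Finset.Icc 1 T, ∑ i ∈ Finset.range k, X (i + 1) ω ≤ 1} :=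
    measureReal_mono fun ω hω k hk => (hω k hk).trans zero_le_one
  rw [div_mul_eq_mul_div, div_mul_eq_mul_div, le_div_iff₀ hq]
  calc x * q ≤ ((2 * m + 1) * p) * (q * x) := by nlinarith [mul_nonneg hq.le hx]
    _ = (2 * m + 1) * (p * q * x) := by ring
    _ ≤ (2 * m + 1) * P.real {ω | ∀ k ∈ Finset.Icc 1 T, ∑ i ∈ Finset.range k, X (i + 1) ω ≤ 1} := by
        gcongr
        refine le_trans ?_ (hassoc.trans hmono)
        gcongr
    _ ≤ _ := by gcongr
end
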